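/- Fix θ > 0. There exists a constant C > 0 such that for every H ∈ [1/2, 3/4] and every s > 0, (V_{2,H}(s))^{-1/2} ≤ C · max(1, s^{-3/4}). In particular, the Gaussian densities satisfy p_H(s,x) ≤ (2π)^{-1/2} C max(1, s^{-3/4}) for all H ∈ [1/2,3/4], s > 0 and x ∈ ℝ. -/

import Mathlib

open Real Filter Set

/-- The variance of the fractional Ornstein–Uhlenbeck process with Hurst index `H ∈ (1/2,1)`
and drift parameter `1/θ`. -/
noncomputable def V2frac (θ H t : ℝ) : ℝ :=
  Real.exp (-(2 * t) / θ) *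
    ∫ u in (0:ℝ)..t, ∫ v in (0:ℝ)..t, Real.exp ((u + v) / θ) * |u - v| ^ (2 * H - 2)

/-- The variance function for `H ∈ [1/2,1)`, with the classical Ornstein–Uhlenbeck
variance `(θ/2)(1 - e^{-2t/θ})` at `H = 1/2`. -/
noncomputable def V2 (θ H t : ℝ) : ℝ :=
  if H = 1/2 then θ / 2 * (1 - Real.exp (-(2 * t) / θ)) else V2frac θ H t

/-- The centered Gaussian density with variance `v`, evaluated at `x`. -/
noncomputable def gaussD (v x : ℝ) : ℝ :=
  (Real.sqrt (2 * π * v))⁻¹ * Real.exp (-(x ^ 2) / (2 * v))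

/-- The one-dimensional density `p_H(t,x)` of the fractional Ornstein–Uhlenbeck process. -/
noncomputable def pH (θ H t x : ℝ) : ℝ := gaussD (V2 θ H t) x

theorem aux_integral_lower (f : ℝ → ℝ) (s m c u : ℝ) (hm : 0 < m) (hms : m ≤ s)
    (hf : IntervalIntegrable f MeasureTheory.volume 0 s) (h0 : ∀ v, 0 ≤ f v)
    (hc : ∀ v ∈ Set.Icc (s - m) s, v ≠ u → c ≤ f v) :
    m * c ≤ ∫ v in (0:ℝ)..s, f v := by
  have h1 : IntervalIntegrable f MeasureTheory.volume (s - m) s := by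
    apply hf.mono_set
    rw [Set.uIcc_of_le (by linarith), Set.uIcc_of_le (by linarith)]
    exact Set.Icc_subset_Icc (by linarith) le_rfl
  have h2 : ∫ v in (s-m)..s, f v ≤ ∫ v in (0:ℝ)..s, f v := by
    apply intervalIntegral.integral_mono_interval (by linarith) (by linarith) le_rfl _ hf
    exact Filter.Eventually.of_forall h0
  have h3 : ∫ v in (s-m)..s, c ≤ ∫ v in (s-m)..s, f v := by
    apply intervalIntegral.integral_mono_ae_restrict (by linarith) (by simp) h1
    have hne : ∀ᵐ v ∂(MeasureTheory.volume : MeasureTheory.Measure ℝ), v ≠ u := by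
      simp [MeasureTheory.ae_iff]
    filter_upwards [MeasureTheory.ae_restrict_of_ae hne,
      MeasureTheory.ae_restrict_mem measurableSet_Icc] with v hv1 hv2
    exact hc v hv2 hv1
  rw [intervalIntegral.integral_const, smul_eq_mul] at h3
  have : s - (s - m) = m := by ring
  rw [this] at h3
  linarith

theorem aux_inner_int (θ p s u : ℝ) (hp : -1 < p) :
    IntervalIntegrable (fun v => Real.exp ((u + v) / θ) * |u - v| ^ p)
      MeasureTheory.volume 0 s := by
  apply IntervalIntegrable.continuousOn_mul _ (by fun_prop)
  have h : ∀ b : ℝ, IntervalIntegrable (fun x : ℝ => |x| ^ p) MeasureTheory.volume 0 b := by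
    have hpos : ∀ b : ℝ, 0 ≤ b →
        IntervalIntegrable (fun x : ℝ => |x| ^ p) MeasureTheory.volume 0 b := by
      intro b hb
      apply (intervalIntegral.intervalIntegrable_rpow' (a := 0) (b := b) hp).congr
      intro x hx
      rw [Set.uIoc_of_le hb] at hx
      simp only [abs_of_pos hx.1]
    intro b
    rcases le_total 0 b with hb | hb
    · exact hpos b hb
    · have := (hpos (-b) (by linarith)).comp_mul_left (c := -1)
      simpa using this
  have h2 : IntervalIntegrable (fun x : ℝ => |x| ^ p) MeasureTheory.volume (u - 0) (u - s) :=
    (h _).symm.trans (h _)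
  have := h2.comp_sub_left u
  simpa using this

theorem aux_frac (θ H s m : ℝ) (hθ : 0 < θ) (h1 : 1/2 < H) (h2 : H ≤ 3/4)
    (hm : 0 < m) (hms : m ≤ s) (hm1 : m ≤ 1) :
    V2frac θ H s = 0 ∨ Real.exp (-2/θ) * m ^ ((3:ℝ)/2) ≤ V2frac θ H s := by
  unfold V2frac
  by_cases hG : IntervalIntegrable (fun u => ∫ v in (0:ℝ)..s,
      Real.exp ((u + v) / θ) * |u - v| ^ (2 * H - 2)) MeasureTheory.volume 0 s
  swap
  · left
    rw [intervalIntegral.integral_undef hG, mul_zero]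
  right
  have key : m * (m * (Real.exp (2 * (s - m) / θ) * m ^ (2 * H - 2))) ≤
      ∫ u in (0:ℝ)..s, ∫ v in (0:ℝ)..s, Real.exp ((u + v) / θ) * |u - v| ^ (2 * H - 2) := by
    apply aux_integral_lower _ s m _ 0 hm hms hG
    · intro u
      apply intervalIntegral.integral_nonneg (by linarith)
      intro v _
      positivity
    · intro u hu _
      apply aux_integral_lower _ s m _ u hm hms (aux_inner_int θ _ s u (by linarith))
      · intro v
        positivity
      · intro v hv hvu
        have hpos : 0 < |u - v| := abs_pos.mpr (sub_ne_zero.mpr (Ne.symm hvu))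
        have hle : |u - v| ≤ m := by
          rw [abs_le]; constructor <;> linarith [hu.1, hu.2, hv.1, hv.2]
        apply mul_le_mul
        · apply Real.exp_le_exp.mpr
          apply div_le_div_of_nonneg_right _ hθ.le
          linarith [hu.1, hv.1]
        · exact Real.rpow_le_rpow_of_nonpos hpos hle (by linarith)
        · positivity
        · positivity
  refine le_trans ?_ (mul_le_mul_of_nonneg_left key (Real.exp_pos _).le)
  have e1 : Real.exp (-(2 * s) / θ) * (m * (m * (Real.exp (2 * (s - m) / θ) * m ^ (2 * H - 2))))
      = Real.exp (-2 * m / θ) * m ^ (2 * H) := by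
    have a : Real.exp (-2 * m / θ) = Real.exp (-(2 * s) / θ) * Real.exp (2 * (s - m) / θ) := by
      rw [← Real.exp_add]; congr 1; ring
    have b : m ^ (2 * H) = m * m * m ^ (2 * H - 2) := by
      rw [Real.rpow_sub hm, Real.rpow_two]; field_simp
    rw [a, b]; ring
  rw [e1]
  apply mul_le_mul
  · apply Real.exp_le_exp.mpr
    apply div_le_div_of_nonneg_right _ hθ.le
    linarith
  · exact Real.rpow_le_rpow_of_exponent_ge hm hm1 (by linarith)
  · positivity
  · positivity

theorem aux_V2 (θ H s m : ℝ) (hθ : 0 < θ) (h1 : 1/2 ≤ H) (h2 : H ≤ 3/4)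
    (hm : 0 < m) (hms : m ≤ s) (hm1 : m ≤ 1) :
    V2 θ H s = 0 ∨ Real.exp (-2/θ) * m ^ ((3:ℝ)/2) ≤ V2 θ H s := by
  unfold V2
  split_ifs with h
  · right
    have a : m ^ ((3:ℝ)/2) ≤ m := by
      simpa using Real.rpow_le_rpow_of_exponent_ge hm hm1 (show (1:ℝ) ≤ 3/2 by norm_num)
    have b : Real.exp (-(2 * s) / θ) ≤ Real.exp (-(2 * m / θ)) := by
      apply Real.exp_le_exp.mpr
      rw [← neg_div]
      apply div_le_div_of_nonneg_right _ hθ.le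
      linarith
    have c : 2 * m / θ * Real.exp (-(2 * m / θ)) ≤ 1 - Real.exp (-(2 * m / θ)) := by
      have := Real.add_one_le_exp (2 * m / θ)
      have h3 : Real.exp (2 * m / θ) * Real.exp (-(2 * m / θ)) = 1 := by
        rw [← Real.exp_add]; simp
      nlinarith [Real.exp_pos (-(2 * m / θ))]
    have d : Real.exp (-2/θ) ≤ Real.exp (-(2 * m / θ)) := by
      apply Real.exp_le_exp.mpr
      rw [← neg_div]
      apply div_le_div_of_nonneg_right _ hθ.le
      linarith
    calc Real.exp (-2/θ) * m ^ ((3:ℝ)/2) ≤ Real.exp (-(2 * m / θ)) * m := by gcongr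
      _ = θ / 2 * (2 * m / θ * Real.exp (-(2 * m / θ))) := by field_simp
      _ ≤ θ / 2 * (1 - Real.exp (-(2 * s) / θ)) := by
        apply mul_le_mul_of_nonneg_left _ (by positivity)
        linarith
  · exact aux_frac θ H s m hθ (lt_of_le_of_ne h1 (Ne.symm h)) h2 hm hms hm1

theorem aux_main (θ H s : ℝ) (hθ : 0 < θ) (h1 : 1/2 ≤ H) (h2 : H ≤ 3/4) (hs : 0 < s) :
    0 ≤ V2 θ H s ∧
      (V2 θ H s) ^ (-(1:ℝ)/2) ≤ Real.exp (1/θ) * max 1 (s ^ (-(3:ℝ)/4)) := by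
  have hm : 0 < min s 1 := lt_min hs one_pos
  rcases aux_V2 θ H s (min s 1) hθ h1 h2 hm (min_le_left _ _) (min_le_right _ _) with h | h
  · rw [h]
    refine ⟨le_rfl, ?_⟩
    rw [Real.zero_rpow (by norm_num)]
    positivity
  · have hp : 0 < Real.exp (-2/θ) * (min s 1) ^ ((3:ℝ)/2) := by positivity
    refine ⟨hp.le.trans h, ?_⟩
    refine (Real.rpow_le_rpow_of_nonpos hp h (by norm_num)).trans ?_
    rw [Real.mul_rpow (by positivity) (by positivity), ← Real.exp_mul, ← Real.rpow_mul hm.le]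
    have e : -2 / θ * (-(1:ℝ)/2) = 1 / θ := by ring
    rw [e]
    apply mul_le_mul_of_nonneg_left _ (Real.exp_pos _).le
    have e2 : (3:ℝ)/2 * (-(1:ℝ)/2) = -3/4 := by norm_num
    rw [e2]
    rcases le_total s 1 with h | h
    · rw [min_eq_left h]; exact le_max_right _ _
    · rw [min_eq_right h, Real.one_rpow]; exact le_max_left _ _

/-- A bound `(V_{2,H}(s))^{-1/2} ≤ C max(1, s^{-3/4})`, uniform over `H ∈ [1/2,3/4]`, and the
resulting bound on the Gaussian densities `p_H`. -/
theorem V2_inv_sqrt_uniform_bound (θ : ℝ) (hθ : 0 < θ) :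
    ∃ C > (0:ℝ),
      (∀ H ∈ Set.Icc (1/2 : ℝ) (3/4), ∀ s > (0:ℝ),
        (V2 θ H s) ^ (-(1:ℝ)/2) ≤ C * max 1 (s ^ (-(3:ℝ)/4))) ∧
      (∀ H ∈ Set.Icc (1/2 : ℝ) (3/4), ∀ s > (0:ℝ), ∀ x : ℝ,
        pH θ H s x ≤ (Real.sqrt (2 * π))⁻¹ * (C * max 1 (s ^ (-(3:ℝ)/4)))) := by
  refine ⟨Real.exp (1/θ), Real.exp_pos _, ?_, ?_⟩
  · intro H hH s hs
    exact (aux_main θ H s hθ hH.1 hH.2 hs).2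
  · intro H hH s hs x
    obtain ⟨h0, hb⟩ := aux_main θ H s hθ hH.1 hH.2 hs
    unfold pH gaussD
    have e : (V2 θ H s) ^ (-(1:ℝ)/2) = (Real.sqrt (V2 θ H s))⁻¹ := by
      rw [Real.sqrt_eq_rpow, ← Real.rpow_neg h0]; congr 1; norm_num
    rw [e] at hb
    rw [Real.sqrt_mul (by positivity), mul_inv, mul_assoc]
    apply mul_le_mul_of_nonneg_left _ (by positivity)
    refine le_trans ?_ hb
    apply mul_le_of_le_one_right (by positivity)
    apply Real.exp_le_one_iff.mpr
    apply div_nonpos_of_nonpos_of_nonneg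
    · nlinarith [sq_nonneg x]
    · positivity
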